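/- Let R > 0 and let M : ℝ → ℝ be a function with M(a) ≥ 0 for all a. Define E_M(a,b) = e^{a}·√(e^{−a−b} + R/2) + M(a), and for reals u, u₁, u₂, v define u₁̄ = −ln(e^{−v}·E_M(u,u₁)² + √(2R)·E_M(u,u₁)) and u₂̄ = −ln(e^{−u₁̄}·E_M(u₁,u₂)² + √(2R)·E_M(u₁,u₂)). Suppose that for all u, u₁, u₂, v ∈ ℝ the m-integral identity e^{u₁̄}·√(e^{−u₁̄−v} + R/2) + e^{u₁̄}·√(e^{−u₁̄−u₂̄} + R/2) = e^{u₁}·√(e^{−u₁−u} + R/2) + e^{u₁}·√(e^{−u₁−u₂} + R/2) holds. Then M(a) = e^{a}·√(R/2) for all a ∈ ℝ. -/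

import Mathlib

/-- The coefficient E_M(a,b) = e^a √(e^{−a−b} + R/2) + M(a). -/
noncomputable def EcoefM (R : ℝ) (M : ℝ → ℝ) (a b : ℝ) : ℝ :=
  Real.exp a * Real.sqrt (Real.exp (-a - b) + R / 2) + M a

/-- u₁̄ as a function of u, u₁ and v = u_{\bar 1}. -/
noncomputable def u1bar (R : ℝ) (M : ℝ → ℝ) (u u₁ v : ℝ) : ℝ :=
  -Real.log (Real.exp (-v) * (EcoefM R M u u₁) ^ 2 + Real.sqrt (2 * R) * EcoefM R M u u₁)

/-- u₂̄ as a function of u, u₁, u₂ and v = u_{\bar 1}. -/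
noncomputable def u2bar (R : ℝ) (M : ℝ → ℝ) (u u₁ u₂ v : ℝ) : ℝ :=
  -Real.log (Real.exp (-(u1bar R M u u₁ v)) * (EcoefM R M u₁ u₂) ^ 2 +
    Real.sqrt (2 * R) * EcoefM R M u₁ u₂)

theorem EcoefM_pos {R : ℝ} (hR : 0 < R) {M : ℝ → ℝ} (hM : ∀ a : ℝ, 0 ≤ M a) (a b : ℝ) :
    0 < EcoefM R M a b := by
  have := hM a
  unfold EcoefM
  positivity

theorem sqrt_two_mul_eq (R : ℝ) : Real.sqrt (2 * R) = 2 * Real.sqrt (R / 2) := by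
  rw [show 2 * R = 2 ^ 2 * (R / 2) by ring, Real.sqrt_mul (by norm_num),
    Real.sqrt_sq (by norm_num)]

/-- The radicand `(V * E ^ 2 + √(2R) * E) * V + R / 2` is the square of `V * E + √(R/2)`. -/
theorem sqrt_quadratic_add {R V E : ℝ} (hR : 0 < R) (hV : 0 < V) (hE : 0 < E) :
    Real.sqrt ((V * E ^ 2 + Real.sqrt (2 * R) * E) * V + R / 2) =
      V * E + Real.sqrt (R / 2) := by
  have hc : Real.sqrt (R / 2) ^ 2 = R / 2 := Real.sq_sqrt (by positivity)
  rw [sqrt_two_mul_eq, ← Real.sqrt_sq (show 0 ≤ V * E + Real.sqrt (R / 2) by positivity)]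
  congr 1
  linear_combination -hc

theorem exp_neg_u1bar {R : ℝ} (hR : 0 < R) {M : ℝ → ℝ} (hM : ∀ a : ℝ, 0 ≤ M a) (u u₁ v : ℝ) :
    Real.exp (-u1bar R M u u₁ v) =
      Real.exp (-v) * EcoefM R M u u₁ ^ 2 + Real.sqrt (2 * R) * EcoefM R M u u₁ := by
  have := EcoefM_pos hR hM u u₁
  rw [u1bar, neg_neg, Real.exp_log (by positivity)]

theorem exp_neg_u2bar {R : ℝ} (hR : 0 < R) {M : ℝ → ℝ} (hM : ∀ a : ℝ, 0 ≤ M a)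
    (u u₁ u₂ v : ℝ) :
    Real.exp (-u2bar R M u u₁ u₂ v) =
      Real.exp (-u1bar R M u u₁ v) * EcoefM R M u₁ u₂ ^ 2 +
        Real.sqrt (2 * R) * EcoefM R M u₁ u₂ := by
  have := EcoefM_pos hR hM u₁ u₂
  rw [u2bar, neg_neg, Real.exp_log (by positivity)]

/-- The shifted `m`-integral equals `1 / E(u, u₁) + E(u₁, u₂)`. -/
theorem shifted_integral_eq {R : ℝ} (hR : 0 < R) {M : ℝ → ℝ} (hM : ∀ a : ℝ, 0 ≤ M a)
    (u u₁ u₂ v : ℝ) :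
    Real.exp (u1bar R M u u₁ v) *
          Real.sqrt (Real.exp (-(u1bar R M u u₁ v) - v) + R / 2) +
        Real.exp (u1bar R M u u₁ v) *
          Real.sqrt (Real.exp (-(u1bar R M u u₁ v) - u2bar R M u u₁ u₂ v) + R / 2) =
      (EcoefM R M u u₁)⁻¹ + EcoefM R M u₁ u₂ := by
  have hE := EcoefM_pos hR hM u u₁
  have hE' := EcoefM_pos hR hM u₁ u₂
  have h₁ : Real.sqrt (Real.exp (-(u1bar R M u u₁ v) - v) + R / 2) =
      Real.exp (-v) * EcoefM R M u u₁ + Real.sqrt (R / 2) := by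
    rw [sub_eq_add_neg, Real.exp_add, exp_neg_u1bar hR hM,
      sqrt_quadratic_add hR (Real.exp_pos _) hE]
  have h₂ : Real.sqrt (Real.exp (-(u1bar R M u u₁ v) - u2bar R M u u₁ u₂ v) + R / 2) =
      Real.exp (-u1bar R M u u₁ v) * EcoefM R M u₁ u₂ + Real.sqrt (R / 2) := by
    rw [sub_eq_add_neg, add_comm (-u1bar R M u u₁ v), Real.exp_add, exp_neg_u2bar hR hM,
      sqrt_quadratic_add hR (Real.exp_pos _) hE']
  have h₃ : Real.exp (u1bar R M u u₁ v) = (Real.exp (-u1bar R M u u₁ v))⁻¹ := by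
    rw [Real.exp_neg, inv_inv]
  rw [h₁, h₂, h₃, exp_neg_u1bar hR hM, sqrt_two_mul_eq]
  have hV := Real.exp_pos (-v)
  have hc : 0 < Real.sqrt (R / 2) := Real.sqrt_pos.mpr (by positivity)
  generalize EcoefM R M u u₁ = E at *
  have hW : Real.exp (-v) * E + 2 * Real.sqrt (R / 2) ≠ 0 := by positivity
  have hW' : Real.exp (-v) * E ^ 2 + 2 * Real.sqrt (R / 2) * E =
      E * (Real.exp (-v) * E + 2 * Real.sqrt (R / 2)) := by ring
  rw [hW']
  field_simp
  ring

/-- If the m-integral identity holds for all u, u₁, u₂, v, then the unknown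
function M is determined: M(a) = e^a √(R/2). -/
theorem M_determined (R : ℝ) (hR : 0 < R) (M : ℝ → ℝ) (hM : ∀ a : ℝ, 0 ≤ M a)
    (h : ∀ u u₁ u₂ v : ℝ,
      Real.exp (u1bar R M u u₁ v) *
          Real.sqrt (Real.exp (-(u1bar R M u u₁ v) - v) + R / 2) +
        Real.exp (u1bar R M u u₁ v) *
          Real.sqrt (Real.exp (-(u1bar R M u u₁ v) - u2bar R M u u₁ u₂ v) + R / 2) =
      Real.exp u₁ * Real.sqrt (Real.exp (-u₁ - u) + R / 2) +
        Real.exp u₁ * Real.sqrt (Real.exp (-u₁ - u₂) + R / 2)) :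
    ∀ a : ℝ, M a = Real.exp a * Real.sqrt (R / 2) := by
  intro a
  have key := h a a a a
  rw [shifted_integral_eq hR hM] at key
  have hE := EcoefM_pos hR hM a a
  have hinv := mul_inv_cancel₀ hE.ne'
  have hS : Real.sqrt (Real.exp (-a - a) + R / 2) ^ 2 = Real.exp (-a - a) + R / 2 :=
    Real.sq_sqrt (by positivity)
  have hc : Real.sqrt (R / 2) ^ 2 = R / 2 := Real.sq_sqrt (by positivity)
  have hexp : Real.exp a ^ 2 * Real.exp (-a - a) = 1 := by
    rw [pow_two, ← Real.exp_add, ← Real.exp_add, ← Real.exp_zero]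
    ring_nf
  have hinv' : (EcoefM R M a a)⁻¹ =
      Real.exp a * Real.sqrt (Real.exp (-a - a) + R / 2) - M a := by
    have hdef : EcoefM R M a a =
      Real.exp a * Real.sqrt (Real.exp (-a - a) + R / 2) + M a := rfl
    linarith
  rw [hinv', EcoefM] at hinv
  rw [← sq_eq_sq₀ (hM a) (by positivity)]
  linear_combination -hinv + Real.exp a ^ 2 * hS + hexp - Real.exp a ^ 2 * hc
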